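/- Let T be a sublinear operator on ℝ such that for some γ > 0 and all 1 < r ≤ 2, |⟨Tf,g⟩| ≤ C(r−1)^{-γ} Σ_{Q∈𝒮} ⟨f⟩_{r,Q} ⟨g⟩_{r,Q} |Q| for some sparse family 𝒮 (depending on f,g,r), where ⟨f⟩_{r,Q} = (⟨|f|^r⟩_Q)^{1/r}. Then for every w ∈ A_2, ‖T‖_{L^2(w)→L^2(w)} ≤ C′ [w]_{A_2}^{1+γ}. -/

import Mathlib

open MeasureTheory

/-- The `L^r`-average `⟨f⟩_{r,Q} = (⟨|f|^r⟩_Q)^{1/r}` over the interval `Q = (a, b]`. -/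
noncomputable def lrAvg (r : ℝ) (f : ℝ → ℝ) (a b : ℝ) : ℝ :=
  ((b - a)⁻¹ * ∫ x in Set.Ioc a b, |f x| ^ r) ^ (1 / r)

/-- The average of `f` over the bounded interval `(a, b]`. -/
noncomputable def intervalAvg (f : ℝ → ℝ) (a b : ℝ) : ℝ :=
  (b - a)⁻¹ * ∫ x in Set.Ioc a b, f x

open MeasureTheory
open scoped ENNReal NNReal

/-- one-dimensional covering lemma -/
lemma cover_aux {ι : Type*} (a b : ι → ℝ) (s : Finset ι) :
    ∃ t ⊆ s, (⋃ i ∈ t, Set.Ioc (a i) (b i)) = (⋃ i ∈ s, Set.Ioc (a i) (b i)) ∧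
      ∀ x, ∀ u ⊆ t, (∀ i ∈ u, x ∈ Set.Ioc (a i) (b i)) → u.card ≤ 2 := by
  classical
  induction s using Finset.strongInduction with
  | H s ih =>
    by_cases h : ∃ i ∈ s, Set.Ioc (a i) (b i) ⊆ ⋃ j ∈ s.erase i, Set.Ioc (a j) (b j)
    · obtain ⟨i, hi, hsub⟩ := h
      obtain ⟨t, ht, h1, h2⟩ := ih (s.erase i) (Finset.erase_ssubset hi)
      refine ⟨t, ht.trans (Finset.erase_subset _ _), ?_, h2⟩
      rw [h1]
      conv_rhs => rw [← Finset.insert_erase hi]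
      rw [Finset.set_biUnion_insert]
      exact (Set.union_eq_self_of_subset_left hsub).symm
    · refine ⟨s, subset_rfl, rfl, ?_⟩
      intro x u hu hx
      by_contra hcard
      push Not at hcard h
      have hne : u.Nonempty := by
        rw [← Finset.card_pos]; omega
      obtain ⟨i, hi, himin⟩ := u.exists_min_image a hne
      obtain ⟨j, hj, hjmax⟩ := u.exists_max_image b hne
      obtain ⟨k, hk, hkn⟩ : ∃ k ∈ u, k ∉ ({i, j} : Finset ι) := by
        apply Finset.exists_mem_notMem_of_card_lt_card
        exact lt_of_le_of_lt Finset.card_le_two hcard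
      simp only [Finset.mem_insert, Finset.mem_singleton, not_or] at hkn
      apply h k (hu hk)
      intro y hy
      simp only [Set.mem_iUnion, Finset.mem_erase]
      have h1 := hx i hi
      have h2 := hx j hj
      have h3 := himin k hk
      have h4 := hjmax k hk
      rcases le_total y x with h5 | h5
      · exact ⟨i, ⟨Ne.symm hkn.1, hu hi⟩, lt_of_le_of_lt h3 hy.1, h5.trans h1.2⟩
      · exact ⟨j, ⟨Ne.symm hkn.2, hu hj⟩, lt_of_lt_of_le h2.1 h5, hy.2.trans h4⟩

lemma cover_sum {ι : Type*} (a b : ι → ℝ) (s : Finset ι) :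
    ∃ t ⊆ s, (⋃ i ∈ t, Set.Ioc (a i) (b i)) = (⋃ i ∈ s, Set.Ioc (a i) (b i)) ∧
      ∀ μ : Measure ℝ, ∑ i ∈ t, μ (Set.Ioc (a i) (b i)) ≤
        2 * μ (⋃ i ∈ s, Set.Ioc (a i) (b i)) := by
  classical
  obtain ⟨t, ht, h1, h2⟩ := cover_aux a b s
  refine ⟨t, ht, h1, fun μ => ?_⟩
  have hm : MeasurableSet (⋃ i ∈ s, Set.Ioc (a i) (b i)) :=
    Finset.measurableSet_biUnion _ fun i _ => measurableSet_Ioc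
  calc ∑ i ∈ t, μ (Set.Ioc (a i) (b i))
      = ∑ i ∈ t, ∫⁻ x, (Set.Ioc (a i) (b i)).indicator 1 x ∂μ := by
        refine Finset.sum_congr rfl fun i _ => ?_
        rw [lintegral_indicator_one measurableSet_Ioc]
    _ = ∫⁻ x, ∑ i ∈ t, (Set.Ioc (a i) (b i)).indicator 1 x ∂μ := by
        rw [lintegral_finsetSum]
        intro i _
        exact measurable_one.indicator measurableSet_Ioc
    _ ≤ ∫⁻ x, (⋃ i ∈ s, Set.Ioc (a i) (b i)).indicator (fun _ => 2) x ∂μ := by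
        refine lintegral_mono fun x => ?_
        by_cases hx : x ∈ ⋃ i ∈ s, Set.Ioc (a i) (b i)
        · rw [Set.indicator_of_mem hx]
          have h3 := h2 x (t.filter fun i => x ∈ Set.Ioc (a i) (b i)) (Finset.filter_subset _ _)
            (fun i hi => (Finset.mem_filter.1 hi).2)
          have : ∑ i ∈ t, (Set.Ioc (a i) (b i)).indicator (1 : ℝ → ℝ≥0∞) x =
            ((t.filter fun i => x ∈ Set.Ioc (a i) (b i)).card : ℝ≥0∞) := by
            simp [Set.indicator_apply, Finset.sum_boole]
          rw [this]
          have h4 : ((t.filter fun i => x ∈ Set.Ioc (a i) (b i)).card : ℝ≥0∞) ≤ ((2 : ℕ) : ℝ≥0∞) :=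
            Nat.cast_le.2 h3
          simpa using h4
        · rw [Set.indicator_of_notMem hx]
          rw [← h1] at hx
          simp only [Set.mem_iUnion, not_exists] at hx
          refine le_of_eq (Finset.sum_eq_zero fun i hi => ?_)
          exact Set.indicator_of_notMem (hx i hi) _
    _ = _ := by
        rw [lintegral_indicator hm]; simp

/-- maximal theorem for finite families, linearised -/
lemma carleson {ι : Type*} (ν : Measure ℝ) (a b : ι → ℝ) (E : ι → Set ℝ) (s : Finset ι)
    (F : ℝ → ℝ≥0∞) (hF : Measurable F) (c : ι → ℝ≥0)
    (hfin : ∀ i ∈ s, ν (Set.Ioc (a i) (b i)) ≠ ∞)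
    (hc : ∀ i ∈ s, c i * ν (Set.Ioc (a i) (b i)) ≤ ∫⁻ x in Set.Ioc (a i) (b i), F x ∂ν)
    (hE : ∀ i ∈ s, MeasurableSet (E i)) (hEI : ∀ i ∈ s, E i ⊆ Set.Ioc (a i) (b i))
    (hd : Pairwise (Function.onFun Disjoint E)) (p : ℝ) (hp : 1 < p) :
    ∑ i ∈ s, (c i : ℝ≥0∞) ^ p * ν (E i) ≤
      ENNReal.ofReal (2 * p / (p - 1)) ^ p * ∫⁻ x, F x ^ p ∂ν := by
  classical
  set N : ℝ → ℝ≥0 := fun x => s.sup fun i => (Set.Ioc (a i) (b i)).indicator (fun _ => c i) x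
    with hN
  have hNm : Measurable N := by
    rw [hN]
    clear_value N
    clear hN hfin hc hE hEI
    induction s using Finset.induction_on with
    | empty => simp
    | insert i s hi ih =>
      simp only [Finset.sup_insert]
      exact (measurable_const.indicator measurableSet_Ioc).sup ih
  have hp0 : 0 < p := by linarith
  have hp1 : 0 < p - 1 := by linarith
  -- level sets
  have hlev : ∀ t : ℝ, 0 < t → {x | t < (N x : ℝ)} =
      ⋃ i ∈ s.filter (fun i => t < c i), Set.Ioc (a i) (b i) := by
    intro t ht
    lift t to ℝ≥0 using ht.le
    ext x
    simp only [Set.mem_ofPred_eq, NNReal.coe_lt_coe, hN, Finset.lt_sup_iff, Set.mem_iUnion,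
      Finset.mem_filter, exists_prop]
    constructor
    · rintro ⟨i, hi, h⟩
      by_cases hx : x ∈ Set.Ioc (a i) (b i)
      · rw [Set.indicator_of_mem hx] at h
        exact ⟨i, ⟨hi, h⟩, hx⟩
      · rw [Set.indicator_of_notMem hx] at h
        exact absurd h (by simp)
    · rintro ⟨i, ⟨hi, h⟩, hx⟩
      exact ⟨i, hi, by rwa [Set.indicator_of_mem hx]⟩
  have hweak : ∀ t : ℝ, 0 < t → ENNReal.ofReal t * ν {x | t < (N x : ℝ)} ≤
      2 * (ν.withDensity F) {x | t < (N x : ℝ)} := by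
    intro t ht
    rw [hlev t ht]
    obtain ⟨u, hu, h1, h2⟩ := cover_sum a b (s.filter (fun i => t < c i))
    refine le_trans ?_ (h2 (ν.withDensity F))
    rw [← h1]
    calc _ ≤ ENNReal.ofReal t * ∑ i ∈ u, ν (Set.Ioc (a i) (b i)) := by
          gcongr; exact measure_biUnion_finset_le _ _
      _ = ∑ i ∈ u, ENNReal.ofReal t * ν (Set.Ioc (a i) (b i)) := by rw [Finset.mul_sum]
      _ ≤ _ := by
          refine Finset.sum_le_sum fun i hi => ?_
          have hi' := Finset.mem_filter.1 (hu hi)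
          rw [withDensity_apply _ measurableSet_Ioc]
          refine le_trans ?_ (hc i hi'.1)
          gcongr
          rw [← ENNReal.ofReal_coe_nnreal]
          exact ENNReal.ofReal_le_ofReal hi'.2.le
  have hNr : Measurable fun x => (N x : ℝ) := hNm.coe_nnreal_real
  -- X
  set X := ∫⁻ x, (N x : ℝ≥0∞) ^ p ∂ν with hX
  set Y := ∫⁻ x, F x ^ p ∂ν with hY
  have hconv : ∀ q : ℝ, 0 < q → ∀ x, ENNReal.ofReal ((N x : ℝ) ^ q) = (N x : ℝ≥0∞) ^ q := by
    intro q hq x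
    rw [← ENNReal.ofReal_rpow_of_nonneg (by positivity) hq.le, ENNReal.ofReal_coe_nnreal]
  have hX1 : X ≤ ENNReal.ofReal (2 * p / (p - 1)) *
      ∫⁻ x, (N x : ℝ≥0∞) ^ (p - 1) ∂(ν.withDensity F) := by
    rw [hX]
    simp_rw [← hconv p hp0, ← hconv (p - 1) hp1]
    rw [lintegral_rpow_eq_lintegral_meas_lt_mul ν (Filter.Eventually.of_forall fun x => by positivity)
      hNr.aemeasurable hp0,
      lintegral_rpow_eq_lintegral_meas_lt_mul (ν.withDensity F)
      (Filter.Eventually.of_forall fun x => by positivity) hNr.aemeasurable hp1]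
    rw [← mul_assoc, ← ENNReal.ofReal_mul (by positivity)]
    rw [show 2 * p / (p - 1) * (p - 1) = p * 2 by field_simp]
    rw [ENNReal.ofReal_mul hp0.le, mul_assoc]
    gcongr
    rw [← lintegral_const_mul' _ _ (by simp)]
    refine setLIntegral_mono' measurableSet_Ioi fun t ht => ?_
    have ht : 0 < t := ht
    have e : t ^ (p - 1) = t * t ^ (p - 1 - 1) := by
      rw [Real.rpow_sub_one ht.ne' (p - 1)]; field_simp
    rw [e, ENNReal.ofReal_mul ht.le, ← mul_assoc, ← mul_assoc]
    have h5 : ν {x | t < (N x : ℝ)} * ENNReal.ofReal t ≤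
        ENNReal.ofReal 2 * (ν.withDensity F) {x | t < (N x : ℝ)} := by
      rw [mul_comm]
      simpa using hweak t ht
    exact mul_le_mul_left h5 _
  have hX2 : ∫⁻ x, (N x : ℝ≥0∞) ^ (p - 1) ∂(ν.withDensity F) ≤ Y ^ (1 / p) * X ^ ((p - 1) / p) := by
    rw [lintegral_withDensity_eq_lintegral_mul _ hF (by fun_prop)]
    have hpq : p.HolderConjugate (p / (p - 1)) := by
      simpa [Real.conjExponent] using Real.HolderConjugate.conjExponent hp
    refine (ENNReal.lintegral_mul_le_Lp_mul_Lq ν hpq hF.aemeasurable (by fun_prop)).trans_eq ?_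
    rw [one_div_div]
    congr 3
    ext x
    rw [← ENNReal.rpow_mul]
    congr 1; field_simp
  have hXfin : X ≠ ∞ := by
    have : X ≤ ∫⁻ x, ∑ i ∈ s, (Set.Ioc (a i) (b i)).indicator (fun _ => (c i : ℝ≥0∞) ^ p) x ∂ν := by
      refine lintegral_mono fun x => ?_
      rcases s.eq_empty_or_nonempty with hs | hs
      · simp [hN, hs, hp0]
      obtain ⟨i, hi, hi2⟩ := Finset.exists_mem_eq_sup s hs
        fun i => (Set.Ioc (a i) (b i)).indicator (fun _ => c i) x
      have : (N x : ℝ≥0∞) ^ p = (Set.Ioc (a i) (b i)).indicator (fun _ => (c i : ℝ≥0∞) ^ p) x := by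
        simp only [hN, hi2]
        by_cases hx : x ∈ Set.Ioc (a i) (b i)
        · rw [Set.indicator_of_mem hx, Set.indicator_of_mem hx]
        · rw [Set.indicator_of_notMem hx, Set.indicator_of_notMem hx]; simp [hp0]
      rw [this]
      exact Finset.single_le_sum (f := fun i => (Set.Ioc (a i) (b i)).indicator (fun _ => (c i : ℝ≥0∞) ^ p) x) (fun _ _ => zero_le) hi
    refine ne_top_of_le_ne_top ?_ this
    rw [lintegral_finsetSum _ fun i _ => measurable_const.indicator measurableSet_Ioc]
    refine ENNReal.sum_ne_top.2 fun i hi => ?_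
    rw [lintegral_indicator measurableSet_Ioc]
    simp only [lintegral_const, Measure.restrict_apply MeasurableSet.univ, Set.univ_inter]
    exact ENNReal.mul_ne_top (ENNReal.rpow_ne_top_of_nonneg hp0.le (by simp)) (hfin i hi)
  have hXY : X ≤ ENNReal.ofReal (2 * p / (p - 1)) ^ p * Y := by
    by_cases hX0 : X = 0
    · rw [hX0]; exact zero_le
    have h1 : X ≤ (ENNReal.ofReal (2 * p / (p - 1)) * Y ^ (1 / p)) * X ^ ((p - 1) / p) := by
      rw [mul_assoc]; refine hX1.trans ?_; gcongr
    have h2 : X = X ^ (1 / p) * X ^ ((p - 1) / p) := by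
      rw [← ENNReal.rpow_add _ _ hX0 hXfin, show 1 / p + (p - 1) / p = 1 by field_simp; ring, ENNReal.rpow_one]
    have h0 : X ^ ((p - 1) / p) ≠ 0 := by
      simp [ENNReal.rpow_eq_zero_iff, hX0, hXfin]
    have h00 : X ^ ((p - 1) / p) ≠ ∞ := by
      refine ENNReal.rpow_ne_top_of_nonneg (by positivity) hXfin
    have h3 : X ^ (1 / p) ≤ ENNReal.ofReal (2 * p / (p - 1)) * Y ^ (1 / p) := by
      rw [← ENNReal.mul_le_mul_iff_left h0 h00, ← h2]
      exact h1
    have h4 := ENNReal.rpow_le_rpow h3 hp0.le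
    rw [ENNReal.mul_rpow_of_nonneg _ _ hp0.le, ← ENNReal.rpow_mul, ← ENNReal.rpow_mul,
      one_div_mul_cancel hp0.ne', ENNReal.rpow_one, ENNReal.rpow_one] at h4
    exact h4
  refine le_trans ?_ hXY
  calc ∑ i ∈ s, (c i : ℝ≥0∞) ^ p * ν (E i) ≤ ∑ i ∈ s, ∫⁻ x in E i, (N x : ℝ≥0∞) ^ p ∂ν := by
        refine Finset.sum_le_sum fun i hi => ?_
        rw [← setLIntegral_const]
        refine setLIntegral_mono' (hE i hi) fun x hx => ?_
        gcongr
        have := Finset.le_sup (f := fun i => (Set.Ioc (a i) (b i)).indicator (fun _ => c i) x) hi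
        simpa [Set.indicator_of_mem (hEI i hi hx)] using this
    _ = ∫⁻ x in ⋃ i ∈ s, E i, (N x : ℝ≥0∞) ^ p ∂ν := by
        rw [lintegral_biUnion_finset (fun i _ j _ hij => hd hij) hE]
    _ ≤ X := setLIntegral_le_lintegral _ _

lemma good_interval (w : ℝ → ℝ) (hwi : LocallyIntegrable w volume) (a b x l : ℝ)
    (hax : a < x) (hxb : x < b) (hl : intervalAvg w a b ≤ l) (hwx : l < w x)
    (hD : HasDerivAt (fun y => ∫ t in a..y, w t) (w x) x) :
    ∃ c d, a ≤ c ∧ c < x ∧ x < d ∧ d ≤ b ∧ ∫ t in Set.Ioc c d, w t = l * (d - c) := by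
  set F : ℝ → ℝ := fun y => ∫ t in a..y, w t with hF
  have hintg : ∀ u v, IntervalIntegrable w volume u v := fun u v =>
    intervalIntegrable_iff.mpr ((hwi.integrableOn_isCompact isCompact_uIcc).mono_set Set.uIoc_subset_uIcc)
  have hFc : Continuous F := intervalIntegral.continuous_primitive (fun u v => hintg u v) a
  have hab : a < b := hax.trans hxb
  -- derivative of H at 0
  set H : ℝ → ℝ := fun s => F (x + s * (b - x)) - F (x - s * (x - a)) - l * (s * (b - a)) with hH
  have hHc : Continuous H := by fun_prop
  have hH0 : H 0 = 0 := by simp [hH]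
  have hHd : HasDerivAt H ((w x - l) * (b - a)) 0 := by
    have h1 : HasDerivAt (fun s : ℝ => x + s * (b - x)) (b - x) 0 := by
      simpa using ((hasDerivAt_id (0:ℝ)).mul_const (b - x)).const_add x
    have h2 : HasDerivAt (fun s : ℝ => x - s * (x - a)) (-(x - a)) 0 := by
      simpa using ((hasDerivAt_id (0:ℝ)).mul_const (x - a)).const_sub x
    have h3 : HasDerivAt (fun s : ℝ => l * (s * (b - a))) (l * (b - a)) 0 := by
      simpa using ((hasDerivAt_id (0:ℝ)).mul_const (b - a)).const_mul l
    have h4 : HasDerivAt (fun s : ℝ => F (x + s * (b - x))) (w x * (b - x)) 0 :=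
      HasDerivAt.comp (h₂ := F) (0:ℝ) (by simpa using hD) h1
    have h5 : HasDerivAt (fun s : ℝ => F (x - s * (x - a))) (w x * -(x - a)) 0 :=
      HasDerivAt.comp (h₂ := F) (0:ℝ) (by simpa using hD) h2
    exact ((h4.sub h5).sub h3).congr_deriv (by ring)
  have hpos : 0 < (w x - l) * (b - a) := mul_pos (by linarith) (by linarith)
  have hev : ∀ᶠ s in nhdsWithin 0 (Set.Ioi 0), 0 < H s := by
    have := (hasDerivAt_iff_tendsto_slope.1 hHd)
    have h6 := this.eventually_const_lt hpos
    have h7 := h6.filter_mono (nhdsWithin_mono (0:ℝ) (s := Set.Ioi 0) (fun y hy => ne_of_gt hy))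
    filter_upwards [h7, self_mem_nhdsWithin] with s hs hs0
    rw [slope_def_field, hH0] at hs
    have hs0 : 0 < s := hs0
    simp only [sub_zero] at hs
    exact (div_pos_iff_of_pos_right hs0).1 hs
  have hI : Set.Ioo (0:ℝ) 1 ∈ nhdsWithin 0 (Set.Ioi 0) := Ioo_mem_nhdsGT one_pos
  obtain ⟨s0, hs0, hs1⟩ := (hev.and hI).exists
  have hseg : ∀ c d, c ≤ d → ∫ t in Set.Ioc c d, w t = F d - F c := by
    intro c d hcd
    rw [hF]
    simp only
    rw [intervalIntegral.integral_interval_sub_left (hintg _ _) (hintg _ _),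
      intervalIntegral.integral_of_le hcd]
  have hH1 : H 1 ≤ 0 := by
    simp only [hH]
    rw [intervalAvg, hseg a b hab.le, inv_mul_le_iff₀ (by linarith)] at hl
    rw [show x + 1 * (b - x) = b by ring, show x - 1 * (x - a) = a by ring]
    linarith
  obtain ⟨s, hs, hs2⟩ := intermediate_value_Icc' hs1.2.le hHc.continuousOn ⟨hH1, hs0.le⟩
  have hsp : 0 < s := lt_of_lt_of_le hs1.1 hs.1
  refine ⟨x - s * (x - a), x + s * (b - x), ?_, ?_, ?_, ?_, ?_⟩
  · nlinarith [hs.2]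
  · nlinarith
  · nlinarith
  · nlinarith [hs.2]
  · rw [hseg _ _ (by nlinarith)]
    simp only [hH] at hs2
    linarith

lemma half_good (w : ℝ → ℝ) (hw : Measurable w) (hpos : ∀ x, 0 < w x)
    (hsi : LocallyIntegrable (fun x => (w x)⁻¹) volume) (W : ℝ) (hW : 1 ≤ W)
    (hA : ∀ a b : ℝ, a < b → intervalAvg w a b * intervalAvg (fun x => (w x)⁻¹) a b ≤ W)
    (l c d : ℝ) (hl : 0 < l) (hcd : c < d) (hav : ∫ t in Set.Ioc c d, w t = l * (d - c)) :
    volume (Set.Ioc c d) ≤ 2 * (volume.restrict {x | l ≤ 2 * W * w x}) (Set.Ioc c d) := by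
  have hG : MeasurableSet {x | l ≤ 2 * W * w x} := measurableSet_le measurable_const (by fun_prop)
  have h1 := hA c d hcd
  have hdc : 0 < d - c := by linarith
  rw [intervalAvg, intervalAvg, hav] at h1
  have h2 : ∫ t in Set.Ioc c d, (w t)⁻¹ ≤ W * (d - c) / l := by
    rw [le_div_iff₀ hl]
    rw [show (d - c)⁻¹ * (l * (d - c)) = l by field_simp, mul_comm, mul_assoc, inv_mul_le_iff₀ hdc] at h1
    linarith
  have h3 := mul_meas_ge_le_integral_of_nonneg (μ := volume.restrict (Set.Ioc c d))
    (f := fun t => (w t)⁻¹) (Filter.Eventually.of_forall fun t => (inv_pos.2 (hpos t)).le)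
    ((hsi.integrableOn_isCompact isCompact_Icc).mono_set Set.Ioc_subset_Icc_self) (2 * W / l)
  have h4 : (volume.restrict (Set.Ioc c d)).real {x | 2 * W / l ≤ (w x)⁻¹} ≤ (d - c) / 2 := by
    have h5 := h3.trans h2
    have h6 : 0 < 2 * W / l := by positivity
    have : W * (d - c) / l = 2 * W / l * ((d - c) / 2) := by field_simp
    rw [this] at h5
    exact le_of_mul_le_mul_left h5 h6
  have h7 : volume (Set.Ioc c d) ≤ (volume.restrict {x | l ≤ 2 * W * w x}) (Set.Ioc c d) +
      (volume.restrict (Set.Ioc c d)) {x | 2 * W / l ≤ (w x)⁻¹} := by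
    rw [Measure.restrict_apply measurableSet_Ioc, Measure.restrict_apply
      (measurableSet_le measurable_const (by fun_prop))]
    refine (measure_mono ?_).trans (measure_union_le _ _)
    intro x hx
    by_cases h : l ≤ 2 * W * w x
    · exact Or.inl ⟨hx, h⟩
    · refine Or.inr ⟨?_, hx⟩
      push Not at h
      have := hpos x
      change 2 * W / l ≤ (w x)⁻¹
      rw [div_le_iff₀ hl, inv_mul_eq_div, le_div_iff₀ this]
      exact h.le
  have h8 : (volume.restrict (Set.Ioc c d)) {x | 2 * W / l ≤ (w x)⁻¹} ≤ ENNReal.ofReal ((d - c) / 2) := by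
    rw [← ENNReal.ofReal_toReal (measure_ne_top _ _)]
    exact ENNReal.ofReal_le_ofReal h4
  rw [Real.volume_Ioc] at h7 ⊢
  have h9 : (volume.restrict {x | l ≤ 2 * W * w x}) (Set.Ioc c d) ≠ ∞ := by
    refine ne_top_of_le_ne_top ?_ (Measure.restrict_apply_le _ _)
    simp
  rw [← ENNReal.ofReal_toReal h9] at h7 ⊢
  set y := ((volume.restrict {x | l ≤ 2 * W * w x}) (Set.Ioc c d)).toReal
  have hy : 0 ≤ y := ENNReal.toReal_nonneg
  have h10 := h7.trans (add_le_add_right h8 _)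
  rw [← ENNReal.ofReal_add hy (by linarith), ENNReal.ofReal_le_ofReal_iff (by linarith)] at h10
  rw [← ENNReal.ofReal_ofNat, ← ENNReal.ofReal_mul (by norm_num)]
  apply ENNReal.ofReal_le_ofReal
  linarith

lemma rh_level (w : ℝ → ℝ) (hw : Measurable w) (hpos : ∀ x, 0 < w x)
    (hwi : LocallyIntegrable w volume)
    (hsi : LocallyIntegrable (fun x => (w x)⁻¹) volume) (W : ℝ) (hW : 1 ≤ W)
    (hA : ∀ a b : ℝ, a < b → intervalAvg w a b * intervalAvg (fun x => (w x)⁻¹) a b ≤ W)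
    (a b l : ℝ) (hl0 : 0 < l) (hl : intervalAvg w a b ≤ l) :
    ((volume.restrict (Set.Ioc a b)).withDensity fun x => ENNReal.ofReal (w x)) {x | l < w x} ≤
      ENNReal.ofReal (4 * l) * (volume.restrict (Set.Ioc a b)) {x | l ≤ 2 * W * w x} := by
  set μ := (volume.restrict (Set.Ioc a b)).withDensity fun x => ENNReal.ofReal (w x) with hμ
  have hwion : ∀ c d, IntegrableOn w (Set.Ioc c d) := fun c d =>
    (hwi.integrableOn_isCompact isCompact_Icc).mono_set Set.Ioc_subset_Icc_self
  have : IsFiniteMeasure μ := isFiniteMeasure_withDensity_ofReal (hwion a b).2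
  have hG : MeasurableSet {x | l ≤ 2 * W * w x} := measurableSet_le measurable_const (by fun_prop)
  have hae := _root_.LocallyIntegrable.ae_hasDerivAt_integral hwi
  obtain ⟨D, hDs, hDm, hD0⟩ := Filter.Eventually.exists_measurable_mem hae
  set S := {x | l < w x} ∩ (Set.Ioo a b ∩ D) with hS
  have hSm : MeasurableSet S :=
    (measurableSet_lt measurable_const hw).inter (measurableSet_Ioo.inter hDm)
  have hμac : μ ≪ volume.restrict (Set.Ioc a b) := withDensity_absolutelyContinuous _ _
  have hfull : ∀ᵐ x ∂μ, x ∈ Set.Ioo a b ∩ D := by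
    apply hμac.ae_le
    rw [← restrict_Ioo_eq_restrict_Ioc]
    filter_upwards [ae_restrict_mem measurableSet_Ioo, ae_restrict_of_ae hDs] with x h1 h2
    exact ⟨h1, h2⟩
  have hSeq : μ {x | l < w x} = μ S := by
    apply measure_congr
    filter_upwards [hfull] with x hx
    apply propext
    exact ⟨fun h => ⟨h, hx⟩, fun h => h.1⟩
  rw [hSeq, hSm.measure_eq_iSup_isCompact_of_ne_top (measure_ne_top _ _)]
  refine iSup_le fun K => iSup_le fun hKS => iSup_le fun hK => ?_
  have hch : ∀ x : ℝ, ∃ c d, x ∈ K → (a ≤ c ∧ c < x ∧ x < d ∧ d ≤ b ∧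
      ∫ t in Set.Ioc c d, w t = l * (d - c)) := by
    intro x
    by_cases hx : x ∈ K
    · have hx2 := hKS hx
      obtain ⟨c, d, h⟩ := good_interval w hwi a b x l hx2.2.1.1 hx2.2.1.2 hl hx2.1 (hD0 x hx2.2.2 a)
      exact ⟨c, d, fun _ => h⟩
    · exact ⟨0, 0, fun h => absurd h hx⟩
  choose c d hcd using hch
  obtain ⟨t, htK, hcov⟩ := hK.elim_nhds_subcover (fun x => Set.Ioo (c x) (d x))
    (fun x hx => Ioo_mem_nhds (hcd x hx).2.1 (hcd x hx).2.2.1)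
  obtain ⟨u, hu, h1, h2⟩ := cover_sum c d t
  have huK : ∀ x ∈ u, x ∈ K := fun x hx => htK x (hu hx)
  calc μ K ≤ μ (⋃ x ∈ u, Set.Ioc (c x) (d x)) := by
        rw [h1]
        refine measure_mono (hcov.trans ?_)
        exact Set.iUnion₂_mono fun x _ => Set.Ioo_subset_Ioc_self
    _ ≤ ∑ x ∈ u, μ (Set.Ioc (c x) (d x)) := measure_biUnion_finset_le _ _
    _ ≤ ∑ x ∈ u, ENNReal.ofReal (2 * l) * (volume.restrict {x | l ≤ 2 * W * w x}) (Set.Ioc (c x) (d x)) := by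
        refine Finset.sum_le_sum fun x hx => ?_
        obtain ⟨g1, g2, g3, g4, g5⟩ := hcd x (huK x hx)
        have hlt := g2.trans g3
        have g6 := half_good w hw hpos hsi W hW hA l _ _ hl0 hlt g5
        rw [hμ, withDensity_apply _ measurableSet_Ioc, Measure.restrict_restrict measurableSet_Ioc,
          Set.inter_eq_left.2 (Set.Ioc_subset_Ioc g1 g4),
          ← ofReal_integral_eq_lintegral_ofReal (hwion _ _)
            (Filter.Eventually.of_forall fun x => (hpos x).le), g5, ENNReal.ofReal_mul hl0.le,
            mul_comm 2 l, ENNReal.ofReal_mul hl0.le, mul_assoc]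
        gcongr
        rw [Real.volume_Ioc] at g6
        simpa using g6
    _ ≤ ENNReal.ofReal (2 * l) * (2 * (volume.restrict {x | l ≤ 2 * W * w x}) (⋃ x ∈ t, Set.Ioc (c x) (d x))) := by
        rw [← Finset.mul_sum]
        gcongr
        exact h2 _
    _ ≤ ENNReal.ofReal (4 * l) * (volume.restrict (Set.Ioc a b)) {x | l ≤ 2 * W * w x} := by
        rw [← mul_assoc, show (4:ℝ) * l = 2 * l * 2 by ring,
          ENNReal.ofReal_mul (by positivity : 0 ≤ 2 * l), ENNReal.ofReal_ofNat]
        refine mul_le_mul_right ?_ _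
        rw [Measure.restrict_apply hG, Measure.restrict_apply
          (Finset.measurableSet_biUnion _ fun _ _ => measurableSet_Ioc), Set.inter_comm]
        refine measure_mono (Set.inter_subset_inter_right _ ?_)
        refine Set.iUnion₂_subset fun x hx => ?_
        obtain ⟨g1, g2, g3, g4, g5⟩ := hcd x (htK x hx)
        exact Set.Ioc_subset_Ioc g1 g4

lemma rpow_small (A d : ℝ) (hA : 1 ≤ A) (hd : 0 < d) (h : A * d ≤ 1 / 2) : A ^ d ≤ 2 := by
  have h1 : Real.log A ≤ A := (Real.log_le_sub_one_of_pos (by linarith)).trans (by linarith)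
  rw [Real.rpow_def_of_pos (by linarith)]
  have h2 : Real.log A * d ≤ 1 / 2 := (mul_le_mul_of_nonneg_right h1 hd.le).trans h
  have h3 : Real.exp (Real.log A * d) ≤ Real.exp (1 / 2) := Real.exp_le_exp.2 h2
  refine h3.trans ?_
  have h4 : Real.exp (1 / 2) * Real.exp (1 / 2) = Real.exp 1 := by
    rw [← Real.exp_add]; norm_num
  have h5 := Real.exp_one_lt_d9
  nlinarith [Real.exp_pos (1 / 2)]

lemma rh_const (W d : ℝ) (hW : 1 ≤ W) (hd : d = 1 / (32 * W)) :
    d / (1 + d) * 4 * (2 * W) ^ (1 + d) ≤ 1 / 2 := by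
  have hd0 : 0 < d := by rw [hd]; positivity
  have hWd : W * d = 1 / 32 := by rw [hd]; field_simp
  have h1 : (2 * W) ^ d ≤ 2 := rpow_small _ _ (by linarith) hd0 (by nlinarith)
  rw [Real.rpow_add (by linarith), Real.rpow_one]
  have h2 : d / (1 + d) ≤ d := div_le_self hd0.le (by linarith)
  have h3 : 0 < (2 * W) ^ d := Real.rpow_pos_of_pos (by linarith) _
  calc d / (1 + d) * 4 * (2 * W * (2 * W) ^ d) ≤ d * 4 * (2 * W * 2) := by gcongr
    _ = 16 * (W * d) := by ring
    _ = 1 / 2 := by rw [hWd]; norm_num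

lemma rh_trunc (w : ℝ → ℝ) (hw : Measurable w) (hpos : ∀ x, 0 < w x)
    (hwi : LocallyIntegrable w volume)
    (hsi : LocallyIntegrable (fun x => (w x)⁻¹) volume) (W : ℝ) (hW : 1 ≤ W)
    (hA : ∀ a b : ℝ, a < b → intervalAvg w a b * intervalAvg (fun x => (w x)⁻¹) a b ≤ W)
    (a b d : ℝ) (hab : a < b) (hd : d = 1 / (32 * W)) (N : ℝ) (hN : 0 < N) :
    ∫⁻ x in Set.Ioc a b, ENNReal.ofReal (w x * (min (w x) N) ^ d) ≤
      ENNReal.ofReal (2 * (intervalAvg w a b ^ (1 + d) * (b - a))) := by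
  have hd0 : 0 < d := by rw [hd]; positivity
  set ν := volume.restrict (Set.Ioc a b) with hν
  set μ := ν.withDensity fun x => ENNReal.ofReal (w x) with hμ
  have hwion : IntegrableOn w (Set.Ioc a b) :=
    (hwi.integrableOn_isCompact isCompact_Icc).mono_set Set.Ioc_subset_Icc_self
  have : IsFiniteMeasure μ := isFiniteMeasure_withDensity_ofReal hwion.2
  set l := intervalAvg w a b with hl
  have hint0 : 0 ≤ ∫ x in Set.Ioc a b, w x := integral_nonneg fun x => (hpos x).le
  have hl0 : 0 ≤ l := by
    rw [hl, intervalAvg]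
    have : 0 < b - a := by linarith
    positivity
  set m : ℝ → ℝ := fun x => min (w x) N with hm
  have hmm : Measurable m := hw.min measurable_const
  have hm0 : ∀ x, 0 < m x := fun x => lt_min (hpos x) hN
  have hμuniv : μ Set.univ = ENNReal.ofReal (l * (b - a)) := by
    rw [hμ, withDensity_apply _ MeasurableSet.univ, Measure.restrict_univ, hν,
      ← ofReal_integral_eq_lintegral_ofReal hwion (Filter.Eventually.of_forall fun x => (hpos x).le),
      hl, intervalAvg]
    congr 1
    have : b - a ≠ 0 := by linarith
    field_simp
  set I := ∫⁻ x, ENNReal.ofReal (m x ^ d) ∂μ with hI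
  have hIeq : ∫⁻ x in Set.Ioc a b, ENNReal.ofReal (w x * (min (w x) N) ^ d) = I := by
    rw [hI, hμ, lintegral_withDensity_eq_lintegral_mul _ (by fun_prop) (by fun_prop)]
    refine lintegral_congr fun x => ?_
    rw [Pi.mul_apply, ENNReal.ofReal_mul (hpos x).le]
  have hIfin : I ≠ ∞ := by
    have : I ≤ ∫⁻ x, ENNReal.ofReal (N ^ d) ∂μ := by
      refine lintegral_mono fun x => ENNReal.ofReal_le_ofReal ?_
      exact Real.rpow_le_rpow (hm0 x).le (min_le_right _ _) hd0.le
    refine ne_top_of_le_ne_top ?_ this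
    rw [lintegral_const]
    exact ENNReal.mul_ne_top (by simp) (measure_ne_top _ _)
  have hlev : ∀ t : ℝ, 0 < t → μ {x | t < m x} ≤ μ {x | t ≤ l} +
      ENNReal.ofReal (4 * t) * ν {x | t ≤ 2 * W * m x} := by
    intro t ht
    by_cases htl : t ≤ l
    · refine le_add_right (measure_mono fun x _ => htl)
    · push Not at htl
      refine le_add_left ?_
      by_cases htN : t < N
      · refine (measure_mono ?_).trans ((rh_level w hw hpos hwi hsi W hW hA a b t ht htl.le).trans ?_)
        · intro x hx
          change t < min (w x) N at hx
          exact lt_of_lt_of_le hx (min_le_left _ _)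
        · refine mul_le_mul_right (measure_mono ?_) _
          intro x hx
          change t ≤ 2 * W * min (w x) N
          change t ≤ 2 * W * w x at hx
          rw [mul_min_of_nonneg _ _ (by linarith)]
          exact le_min hx (by nlinarith)
      · have : {x | t < m x} = ∅ := by
          ext x
          simp only [Set.mem_ofPred_eq, Set.mem_empty_iff_false, iff_false, not_lt]
          exact (min_le_right _ _).trans (not_lt.1 htN)
        rw [this]; simp
  have hmain : I ≤ ENNReal.ofReal (l ^ d) * μ Set.univ +
      ENNReal.ofReal (d / (1 + d) * 4) * ∫⁻ x, ENNReal.ofReal ((2 * W * m x) ^ (1 + d)) ∂ν := by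
    have e1 : ENNReal.ofReal (l ^ d) * μ Set.univ = ∫⁻ x, ENNReal.ofReal (((fun _ => l) x) ^ d) ∂μ := by
      rw [lintegral_const]
    rw [e1, hI, lintegral_rpow_eq_lintegral_meas_lt_mul μ
        (Filter.Eventually.of_forall fun x => (hm0 x).le) hmm.aemeasurable hd0,
      lintegral_rpow_eq_lintegral_meas_le_mul μ
        (Filter.Eventually.of_forall fun x => hl0) aemeasurable_const hd0,
      lintegral_rpow_eq_lintegral_meas_le_mul ν (f := fun x => 2 * W * m x)
        (Filter.Eventually.of_forall fun x => by have := hm0 x; positivity)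
        (by fun_prop) (by linarith : 0 < 1 + d)]
    rw [← mul_assoc, ← ENNReal.ofReal_mul (by positivity),
      show d / (1 + d) * 4 * (1 + d) = d * 4 by field_simp, ENNReal.ofReal_mul hd0.le, mul_assoc,
      ← mul_add]
    gcongr
    rw [← lintegral_const_mul' _ _ (by simp), ← lintegral_add_left']
    · refine setLIntegral_mono' measurableSet_Ioi fun t ht => ?_
      have ht : 0 < t := ht
      refine (mul_le_mul_left (hlev t ht) _).trans ?_
      rw [add_mul]
      refine add_le_add_right ?_ _
      rw [ENNReal.ofReal_mul (by norm_num), mul_assoc, mul_assoc]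
      refine mul_le_mul_right ?_ _
      rw [mul_left_comm, ← ENNReal.ofReal_mul ht.le]
      refine mul_le_mul_right (le_of_eq (congrArg _ ?_)) _
      rw [show 1 + d - 1 = (d - 1) + 1 by ring, Real.rpow_add_one ht.ne', mul_comm]
    · refine Measurable.aemeasurable ?_
      refine Measurable.mul ?_ (by fun_prop)
      have : Antitone fun t : ℝ => μ {x : ℝ | t ≤ l} := by
        intro t s hts
        exact measure_mono fun x hx => hts.trans hx
      exact this.measurable
  have hsec : ENNReal.ofReal (d / (1 + d) * 4) * ∫⁻ x, ENNReal.ofReal ((2 * W * m x) ^ (1 + d)) ∂ν ≤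
      ENNReal.ofReal (1 / 2) * I := by
    rw [← hIeq, ← lintegral_const_mul' _ _ (by simp), ← lintegral_const_mul' _ _ (by simp)]
    refine lintegral_mono fun x => ?_
    have hmx := hm0 x
    rw [← ENNReal.ofReal_mul (by positivity), ← ENNReal.ofReal_mul (by norm_num)]
    apply ENNReal.ofReal_le_ofReal
    rw [Real.mul_rpow (by positivity) hmx.le, ← mul_assoc]
    gcongr ?_ * ?_
    · exact rh_const W d hW hd
    · rw [Real.rpow_add hmx, Real.rpow_one]
      gcongr
      exact min_le_left _ _
  rw [hIeq]
  have hfin := hmain.trans (add_le_add_right hsec _)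
  rw [hμuniv, ← ENNReal.ofReal_mul (by positivity), ← ENNReal.ofReal_toReal hIfin,
    ← ENNReal.ofReal_mul (by norm_num)] at hfin
  have hba : 0 < b - a := by linarith
  have hI0 : 0 ≤ I.toReal := ENNReal.toReal_nonneg
  rw [← ENNReal.ofReal_add (by positivity) (by positivity), ENNReal.ofReal_le_ofReal_iff (by positivity)] at hfin
  rw [← ENNReal.ofReal_toReal hIfin]
  apply ENNReal.ofReal_le_ofReal
  have : l ^ (1 + d) = l ^ d * l := by
    rw [Real.rpow_add' hl0 (by positivity), Real.rpow_one, mul_comm]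
  rw [this]
  linarith

lemma rh (w : ℝ → ℝ) (hw : Measurable w) (hpos : ∀ x, 0 < w x)
    (hwi : LocallyIntegrable w volume)
    (hsi : LocallyIntegrable (fun x => (w x)⁻¹) volume) (W : ℝ) (hW : 1 ≤ W)
    (hA : ∀ a b : ℝ, a < b → intervalAvg w a b * intervalAvg (fun x => (w x)⁻¹) a b ≤ W)
    (a b d : ℝ) (hab : a < b) (hd : d = 1 / (32 * W)) :
    ∫⁻ x in Set.Ioc a b, ENNReal.ofReal (w x ^ (1 + d)) ≤
      ENNReal.ofReal (2 * (intervalAvg w a b ^ (1 + d) * (b - a))) := by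
  have hd0 : 0 < d := by rw [hd]; positivity
  have ht : Filter.Tendsto (fun n : ℕ => ∫⁻ x in Set.Ioc a b,
      ENNReal.ofReal (w x * (min (w x) ((n:ℝ) + 1)) ^ d)) Filter.atTop
      (nhds (∫⁻ x in Set.Ioc a b, ENNReal.ofReal (w x ^ (1 + d)))) := by
    refine lintegral_tendsto_of_tendsto_of_monotone (fun n => by fun_prop) ?_ ?_
    · refine Filter.Eventually.of_forall fun x n k hnk => ?_
      apply ENNReal.ofReal_le_ofReal
      have := hpos x
      have h2 : (n : ℝ) ≤ k := Nat.cast_le.2 hnk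
      gcongr
    · refine Filter.Eventually.of_forall fun x => ?_
      refine tendsto_const_nhds.congr' ?_
      obtain ⟨n0, hn0⟩ := exists_nat_ge (w x)
      filter_upwards [Filter.eventually_ge_atTop n0] with n hn
      have h2 : (n0 : ℝ) ≤ n := Nat.cast_le.2 hn
      rw [min_eq_left (by linarith), Real.rpow_add (hpos x), Real.rpow_one]
  exact le_of_tendsto' ht fun n =>
    rh_trunc w hw hpos hwi hsi W hW hA a b d hab hd _ (by positivity)

lemma bdd_rpow_integrableOn (f : ℝ → ℝ) (hf : Measurable f) (hfB : ∃ B : ℝ, ∀ x, |f x| ≤ B)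
    (r : ℝ) (hr : 0 ≤ r) (a b : ℝ) : IntegrableOn (fun x => |f x| ^ r) (Set.Ioc a b) := by
  obtain ⟨B, hB⟩ := hfB
  refine Measure.integrableOn_of_bounded (M := B ^ r) (by simp) (by fun_prop) ?_
  refine Filter.Eventually.of_forall fun x => ?_
  rw [Real.norm_of_nonneg (by positivity)]
  exact Real.rpow_le_rpow (abs_nonneg _) (hB x) hr

lemma sparse_side {ι : Type*} (v : ℝ → ℝ) (hv : Measurable v) (hv0 : ∀ x, 0 < v x)
    (f : ℝ → ℝ) (hf : Measurable f) (hfB : ∃ B : ℝ, ∀ x, |f x| ≤ B)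
    (a b : ι → ℝ) (E : ι → Set ℝ) (s : Finset ι)
    (hvi : ∀ i ∈ s, IntegrableOn v (Set.Ioc (a i) (b i)))
    (hab : ∀ i ∈ s, a i < b i)
    (hE : ∀ i ∈ s, MeasurableSet (E i)) (hEI : ∀ i ∈ s, E i ⊆ Set.Ioc (a i) (b i))
    (hd : Pairwise (Function.onFun Disjoint E)) (d r : ℝ) (hd0 : 0 < d) (hd1 : d ≤ 1)
    (hr : r = 2 * (1 + d) / (2 + d)) :
    ∑ i ∈ s, ENNReal.ofReal ((∫ x in Set.Ioc (a i) (b i), |f x| ^ r) / (∫ x in Set.Ioc (a i) (b i), v x))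
        ^ (2 / r) * (volume.withDensity fun x => ENNReal.ofReal (v x)) (E i) ≤
      36 * ∫⁻ x, ENNReal.ofReal (f x ^ 2 * v x ^ (-(1 + d)⁻¹)) := by
  have hr0 : 0 < r := by rw [hr]; positivity
  have hp : 2 / r = (2 + d) / (1 + d) := by rw [hr]; field_simp
  have hp1 : 1 < 2 / r := by rw [hp, lt_div_iff₀ (by positivity)]; linarith
  set ν := volume.withDensity fun x => ENNReal.ofReal (v x) with hν
  set F : ℝ → ℝ≥0∞ := fun x => ENNReal.ofReal (|f x| ^ r * (v x)⁻¹) with hF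
  have hFm : Measurable F := by fun_prop
  have hνI : ∀ i ∈ s, ν (Set.Ioc (a i) (b i)) = ENNReal.ofReal (∫ x in Set.Ioc (a i) (b i), v x) := by
    intro i hi
    rw [hν, withDensity_apply _ measurableSet_Ioc, ofReal_integral_eq_lintegral_ofReal (hvi i hi)
      (Filter.Eventually.of_forall fun x => (hv0 x).le)]
  have hV : ∀ i ∈ s, 0 < ∫ x in Set.Ioc (a i) (b i), v x := by
    intro i hi
    rw [setIntegral_pos_iff_support_of_nonneg_ae (Filter.Eventually.of_forall fun x => (hv0 x).le) (hvi i hi)]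
    have : Function.support v = Set.univ := by
      ext x; simp [(hv0 x).ne']
    rw [this, Set.univ_inter, Real.volume_Ioc]
    simpa using hab i hi
  have key := carleson ν a b E s F hFm
    (fun i => Real.toNNReal ((∫ x in Set.Ioc (a i) (b i), |f x| ^ r) / (∫ x in Set.Ioc (a i) (b i), v x)))
    (fun i hi => by rw [hνI i hi]; simp) ?_ hE hEI hd (2 / r) hp1
  · refine key.trans ?_
    have h1 : ENNReal.ofReal (2 * (2 / r) / (2 / r - 1)) ^ (2 / r) ≤ 36 := by
      have e1 : 2 * (2 / r) / (2 / r - 1) = 2 * (2 + d) := by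
        rw [hp]
        have : (2 + d) / (1 + d) - 1 = 1 / (1 + d) := by field_simp; ring
        rw [this]; field_simp
      rw [e1]
      have e2 : ENNReal.ofReal (2 * (2 + d)) ≤ 6 := by
        rw [← ENNReal.ofReal_ofNat 6]
        exact ENNReal.ofReal_le_ofReal (by linarith)
      have e3 : 2 / r ≤ 2 := by
        rw [hp, div_le_iff₀ (by positivity)]; linarith
      calc ENNReal.ofReal (2 * (2 + d)) ^ (2 / r) ≤ (6 : ℝ≥0∞) ^ (2 / r) := by gcongr
        _ ≤ (6 : ℝ≥0∞) ^ (2 : ℝ) := ENNReal.rpow_le_rpow_of_exponent_le (by norm_num) e3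
        _ = 36 := by
          rw [show (2 : ℝ) = ((2 : ℕ) : ℝ) by norm_num, ENNReal.rpow_natCast]; norm_num
    have h2 : ∫⁻ x, F x ^ (2 / r) ∂ν = ∫⁻ x, ENNReal.ofReal (f x ^ 2 * v x ^ (-(1 + d)⁻¹)) := by
      rw [hν, lintegral_withDensity_eq_lintegral_mul _ (by fun_prop) (by fun_prop)]
      refine lintegral_congr fun x => ?_
      have hvx := hv0 x
      rw [Pi.mul_apply, hF]
      simp only
      rw [ENNReal.ofReal_rpow_of_nonneg (by positivity) (by positivity), ← ENNReal.ofReal_mul hvx.le]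
      congr 1
      rw [Real.mul_rpow (by positivity) (by positivity), ← Real.rpow_mul (abs_nonneg _),
        mul_div_cancel₀ _ hr0.ne', Real.rpow_two, sq_abs, mul_left_comm]
      congr 1
      rw [← Real.rpow_neg_one, ← Real.rpow_mul hvx.le]
      nth_rewrite 1 [← Real.rpow_one (v x)]
      rw [← Real.rpow_add hvx, hp]
      congr 1
      field_simp
      ring
    rw [h2]
    exact mul_le_mul_left h1 _
  · intro i hi
    have hA := bdd_rpow_integrableOn f hf hfB r hr0.le (a i) (b i)
    have hA0 : 0 ≤ ∫ x in Set.Ioc (a i) (b i), |f x| ^ r := integral_nonneg fun x => by positivity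
    rw [hνI i hi]
    change ENNReal.ofReal _ * _ ≤ _
    rw [← ENNReal.ofReal_mul (div_nonneg hA0 (hV i hi).le), div_mul_cancel₀ _ (hV i hi).ne',
      ofReal_integral_eq_lintegral_ofReal hA (Filter.Eventually.of_forall fun x => by positivity),
      hν, setLIntegral_withDensity_eq_setLIntegral_mul _ (by fun_prop) (by fun_prop) measurableSet_Ioc]
    refine le_of_eq (lintegral_congr fun x => ?_)
    have hvx := hv0 x
    rw [Pi.mul_apply, hF]
    simp only
    rw [← ENNReal.ofReal_mul hvx.le]
    congr 1
    field_simp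

lemma const_two (W d r : ℝ) (hW : 1 ≤ W) (hd : d = 1 / (32 * W)) (hr : r = 2 * (1 + d) / (2 + d)) :
    (4 * W ^ (1 + d)) ^ (1 / r) ≤ 8 * W := by
  have hd0 : 0 < d := by rw [hd]; positivity
  have hWd : W * d = 1 / 32 := by rw [hd]; field_simp
  have hW0 : 0 < W := by linarith
  have hr1 : 1 / r ≤ 1 := by
    rw [hr, one_div_div, div_le_one (by positivity)]; linarith
  rw [Real.mul_rpow (by norm_num) (by positivity), ← Real.rpow_mul hW0.le]
  have e : (1 + d) * (1 / r) = 1 + d / 2 := by rw [hr]; field_simp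
  rw [e, Real.rpow_add hW0, Real.rpow_one]
  have h1 : W ^ (d / 2) ≤ 2 := rpow_small _ _ hW (by linarith) (by nlinarith)
  have h2 : (4 : ℝ) ^ (1 / r) ≤ 4 := by
    calc (4 : ℝ) ^ (1 / r) ≤ (4 : ℝ) ^ (1 : ℝ) := Real.rpow_le_rpow_of_exponent_le (by norm_num) hr1
      _ = 4 := Real.rpow_one _
  calc (4 : ℝ) ^ (1 / r) * (W * W ^ (d / 2)) ≤ 4 * (W * 2) := by gcongr
    _ = 8 * W := by ring

lemma intervalAvg_nonneg (w : ℝ → ℝ) (hpos : ∀ x, 0 < w x) (a b : ℝ) (hab : a < b) :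
    0 ≤ intervalAvg w a b := by
  rw [intervalAvg]
  have : 0 < b - a := by linarith
  have : 0 ≤ ∫ x in Set.Ioc a b, w x := integral_nonneg fun x => (hpos x).le
  positivity

lemma rh_real (w : ℝ → ℝ) (hw : Measurable w) (hpos : ∀ x, 0 < w x)
    (hwi : LocallyIntegrable w volume)
    (hsi : LocallyIntegrable (fun x => (w x)⁻¹) volume) (W : ℝ) (hW : 1 ≤ W)
    (hA : ∀ a b : ℝ, a < b → intervalAvg w a b * intervalAvg (fun x => (w x)⁻¹) a b ≤ W)
    (a b d : ℝ) (hab : a < b) (hd : d = 1 / (32 * W)) :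
    IntegrableOn (fun x => w x ^ (1 + d)) (Set.Ioc a b) ∧
    (∫ x in Set.Ioc a b, w x ^ (1 + d)) / (b - a) ≤ 2 * intervalAvg w a b ^ (1 + d) := by
  have h := rh w hw hpos hwi hsi W hW hA a b d hab hd
  have hba : 0 < b - a := by linarith
  have hnn : 0 ≤ᵐ[volume.restrict (Set.Ioc a b)] fun x => w x ^ (1 + d) :=
    Filter.Eventually.of_forall fun x => Real.rpow_nonneg (hpos x).le _
  have hm : Measurable fun x => w x ^ (1 + d) := by fun_prop
  have hi : IntegrableOn (fun x => w x ^ (1 + d)) (Set.Ioc a b) := by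
    refine ⟨hm.aestronglyMeasurable, ?_⟩
    rw [hasFiniteIntegral_iff_ofReal hnn]
    exact lt_of_le_of_lt h ENNReal.ofReal_lt_top
  refine ⟨hi, ?_⟩
  have := intervalAvg_nonneg w hpos a b hab
  rw [← ofReal_integral_eq_lintegral_ofReal hi hnn, ENNReal.ofReal_le_ofReal_iff (by positivity)] at h
  rw [div_le_iff₀ hba]
  linarith

lemma sparse_fin (w : ℝ → ℝ) (hw : Measurable w) (hpos : ∀ x, 0 < w x)
    (hwi : LocallyIntegrable w volume)
    (hsi : LocallyIntegrable (fun x => (w x)⁻¹) volume) (W : ℝ) (hW : 1 ≤ W)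
    (hA : ∀ a b : ℝ, a < b → intervalAvg w a b * intervalAvg (fun x => (w x)⁻¹) a b ≤ W)
    (d r η : ℝ) (hη : 0 < η) (hd : d = 1 / (32 * W)) (hr : r = 2 * (1 + d) / (2 + d))
    (f g : ℝ → ℝ) (hf : Measurable f) (hfB : ∃ B : ℝ, ∀ x, |f x| ≤ B)
    (hg : Measurable g) (hgB : ∃ B : ℝ, ∀ x, |g x| ≤ B)
    {ι : Type*} (a b : ι → ℝ) (E : ι → Set ℝ) (s : Finset ι)
    (hab : ∀ i ∈ s, a i < b i)
    (hE : ∀ i ∈ s, MeasurableSet (E i)) (hEI : ∀ i ∈ s, E i ⊆ Set.Ioc (a i) (b i))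
    (hEη : ∀ i ∈ s, η * (b i - a i) ≤ (volume (E i)).toReal)
    (hdj : Pairwise (Function.onFun Disjoint E)) :
    ∑ i ∈ s, ENNReal.ofReal (lrAvg r f (a i) (b i) * lrAvg r g (a i) (b i) * (b i - a i)) ≤
      ENNReal.ofReal (288 * W / η) * ((∫⁻ x, ENNReal.ofReal (f x ^ 2 * w x)) ^ (1 / 2 : ℝ) *
        (∫⁻ x, ENNReal.ofReal (g x ^ 2 * (w x)⁻¹)) ^ (1 / 2 : ℝ)) := by
  have hd0 : 0 < d := by rw [hd]; positivity
  have hd1 : d ≤ 1 := by rw [hd, div_le_one (by positivity)]; linarith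
  have hr0 : 0 < r := by rw [hr]; positivity
  set u : ℝ → ℝ := fun x => w x ^ (1 + d) with hu
  set v : ℝ → ℝ := fun x => ((w x)⁻¹) ^ (1 + d) with hv
  have hipos : ∀ x, 0 < (w x)⁻¹ := fun x => inv_pos.2 (hpos x)
  have hu0 : ∀ x, 0 < u x := fun x => Real.rpow_pos_of_pos (hpos x) _
  have hv0 : ∀ x, 0 < v x := fun x => Real.rpow_pos_of_pos (hipos x) _
  have hum : Measurable u := by fun_prop
  have hvm : Measurable v := by fun_prop
  have rhu := fun i (hi : i ∈ s) => rh_real w hw hpos hwi hsi W hW hA (a i) (b i) d (hab i hi) hd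
  have rhv := fun i (hi : i ∈ s) => rh_real (fun x => (w x)⁻¹) (by fun_prop) hipos hsi
    (by simpa using hwi) W hW (by
      intro a b h
      have := hA a b h
      rw [mul_comm] at this
      simpa using this) (a i) (b i) d (hab i hi) hd
  set νv := volume.withDensity fun x => ENNReal.ofReal (v x) with hνv
  set νu := volume.withDensity fun x => ENNReal.ofReal (u x) with hνu
  set X : ι → ℝ≥0∞ := fun i => ENNReal.ofReal ((∫ x in Set.Ioc (a i) (b i), |f x| ^ r) /
    (∫ x in Set.Ioc (a i) (b i), v x)) with hX
  set Y : ι → ℝ≥0∞ := fun i => ENNReal.ofReal ((∫ x in Set.Ioc (a i) (b i), |g x| ^ r) /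
    (∫ x in Set.Ioc (a i) (b i), u x)) with hY
  have hwd : ∀ x, v x ^ (-(1 + d)⁻¹) = w x := by
    intro x
    have := hpos x
    rw [hv]
    simp only
    rw [← Real.rpow_mul (hipos x).le, mul_neg, mul_inv_cancel₀ (by linarith), Real.rpow_neg_one, inv_inv]
  have hwd2 : ∀ x, u x ^ (-(1 + d)⁻¹) = (w x)⁻¹ := by
    intro x
    rw [hu]
    simp only
    rw [← Real.rpow_mul (hpos x).le, mul_neg, mul_inv_cancel₀ (by linarith), Real.rpow_neg_one]
  have hsf := sparse_side v hvm hv0 f hf hfB a b E s (fun i hi => (rhv i hi).1) hab hE hEI hdj d r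
    hd0 hd1 hr
  have hsg := sparse_side u hum hu0 g hg hgB a b E s (fun i hi => (rhu i hi).1) hab hE hEI hdj d r
    hd0 hd1 hr
  simp_rw [hwd] at hsf
  simp_rw [hwd2] at hsg
  -- volume of E
  have hvolE : ∀ i ∈ s, volume (E i) ≤ νv (E i) ^ (1 / 2 : ℝ) * νu (E i) ^ (1 / 2 : ℝ) := by
    intro i hi
    have h2 : (2 : ℝ).HolderConjugate 2 := Real.HolderConjugate.two_two
    have := ENNReal.lintegral_mul_le_Lp_mul_Lq (volume.restrict (E i)) h2
      (f := fun x => ENNReal.ofReal (v x ^ (1 / 2 : ℝ))) (g := fun x => ENNReal.ofReal (u x ^ (1 / 2 : ℝ)))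
      (by fun_prop) (by fun_prop)
    have e1 : ∀ x, ((fun x => ENNReal.ofReal (v x ^ (1 / 2 : ℝ))) * fun x => ENNReal.ofReal (u x ^ (1 / 2 : ℝ))) x = 1 := by
      intro x
      rw [Pi.mul_apply, ← ENNReal.ofReal_mul (Real.rpow_nonneg (hv0 x).le _),
        ← Real.mul_rpow (hv0 x).le (hu0 x).le, hu, hv]
      simp only
      rw [← Real.mul_rpow (hipos x).le (hpos x).le, inv_mul_cancel₀ (hpos x).ne']
      simp
    have e2 : ∀ z : ℝ → ℝ, (∀ x, 0 < z x) → ∀ x, ENNReal.ofReal (z x ^ (1 / 2 : ℝ)) ^ (2 : ℝ) = ENNReal.ofReal (z x) := by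
      intro z hz x
      rw [ENNReal.ofReal_rpow_of_nonneg (Real.rpow_nonneg (hz x).le _) (by norm_num),
        ← Real.rpow_mul (hz x).le]
      norm_num
    simp_rw [e1, e2 v hv0, e2 u hu0] at this
    rw [hνv, hνu, withDensity_apply _ (hE i hi), withDensity_apply _ (hE i hi)]
    simpa using this
  have hterm : ∀ i ∈ s, ENNReal.ofReal (lrAvg r f (a i) (b i) * lrAvg r g (a i) (b i) * (b i - a i)) ≤
      ENNReal.ofReal (8 * W / η) * ((X i ^ (1 / r) * νv (E i) ^ (1 / 2 : ℝ)) *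
        (Y i ^ (1 / r) * νu (E i) ^ (1 / 2 : ℝ))) := by
    intro i hi
    have hl : 0 < b i - a i := by linarith [hab i hi]
    have hEfin : volume (E i) ≠ ∞ := by
      refine ne_top_of_le_ne_top ?_ (measure_mono (hEI i hi))
      simp
    set A := ∫ x in Set.Ioc (a i) (b i), |f x| ^ r with hAd
    set B := ∫ x in Set.Ioc (a i) (b i), |g x| ^ r with hBd
    set V := ∫ x in Set.Ioc (a i) (b i), v x with hVd
    set U := ∫ x in Set.Ioc (a i) (b i), u x with hUd
    have hA0 : 0 ≤ A := integral_nonneg fun x => by positivity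
    have hB0 : 0 ≤ B := integral_nonneg fun x => by positivity
    have hposint : ∀ z : ℝ → ℝ, (∀ x, 0 < z x) → IntegrableOn z (Set.Ioc (a i) (b i)) →
        0 < ∫ x in Set.Ioc (a i) (b i), z x := by
      intro z hz hzi
      rw [setIntegral_pos_iff_support_of_nonneg_ae (Filter.Eventually.of_forall fun x => (hz x).le) hzi]
      have : Function.support z = Set.univ := by
        ext x; simp [(hz x).ne']
      rw [this, Set.univ_inter, Real.volume_Ioc]
      simpa using hab i hi
    have hV0 : 0 < V := hposint v hv0 (rhv i hi).1
    have hU0 : 0 < U := hposint u hu0 (rhu i hi).1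
    have hVU : V / (b i - a i) * (U / (b i - a i)) ≤ 4 * W ^ (1 + d) := by
      have i1 := intervalAvg_nonneg w hpos _ _ (hab i hi)
      have i2 := intervalAvg_nonneg _ hipos _ _ (hab i hi)
      calc V / (b i - a i) * (U / (b i - a i)) ≤
            (2 * intervalAvg (fun x => (w x)⁻¹) (a i) (b i) ^ (1 + d)) * (2 * intervalAvg w (a i) (b i) ^ (1 + d)) :=
            mul_le_mul (rhv i hi).2 (rhu i hi).2 (by positivity) (by positivity)
        _ = 4 * (intervalAvg w (a i) (b i) * intervalAvg (fun x => (w x)⁻¹) (a i) (b i)) ^ (1 + d) := by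
            rw [Real.mul_rpow i1 i2]; ring
        _ ≤ 4 * W ^ (1 + d) := by
            gcongr
            exact hA _ _ (hab i hi)
    have hlr : lrAvg r f (a i) (b i) * lrAvg r g (a i) (b i) ≤
        (A / V) ^ (1 / r) * (B / U) ^ (1 / r) * (8 * W) := by
      rw [lrAvg, lrAvg, ← Real.mul_rpow (by positivity) (by positivity),
        ← Real.mul_rpow (by positivity) (by positivity)]
      have e : (b i - a i)⁻¹ * A * ((b i - a i)⁻¹ * B) =
          A / V * (B / U) * (V / (b i - a i) * (U / (b i - a i))) := by
        field_simp
      rw [e, Real.mul_rpow (by positivity) (by positivity)]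
      gcongr
      exact (Real.rpow_le_rpow (by positivity) hVU (by positivity)).trans (const_two W d r hW hd hr)
    have hl2 : b i - a i ≤ (volume (E i)).toReal / η := by
      rw [le_div_iff₀ hη, mul_comm]; exact hEη i hi
    have hreal : lrAvg r f (a i) (b i) * lrAvg r g (a i) (b i) * (b i - a i) ≤
        8 * W / η * ((A / V) ^ (1 / r) * (B / U) ^ (1 / r) * (volume (E i)).toReal) := by
      calc _ ≤ (A / V) ^ (1 / r) * (B / U) ^ (1 / r) * (8 * W) * ((volume (E i)).toReal / η) :=
            mul_le_mul hlr hl2 hl.le (by positivity)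
        _ = _ := by ring
    refine (ENNReal.ofReal_le_ofReal hreal).trans ?_
    rw [ENNReal.ofReal_mul (by positivity)]
    refine mul_le_mul_right ?_ _
    rw [ENNReal.ofReal_mul (by positivity), ENNReal.ofReal_mul (by positivity), ENNReal.ofReal_toReal hEfin,
      ← ENNReal.ofReal_rpow_of_nonneg (by positivity) (by positivity),
      ← ENNReal.ofReal_rpow_of_nonneg (by positivity) (by positivity)]
    calc _ ≤ X i ^ (1 / r) * Y i ^ (1 / r) * (νv (E i) ^ (1 / 2 : ℝ) * νu (E i) ^ (1 / 2 : ℝ)) :=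
          mul_le_mul_right (hvolE i hi) _
      _ = _ := by ring
  have hsq : ∀ (Z : ℝ≥0∞) (m : ℝ≥0∞), (Z ^ (1 / r) * m ^ (1 / 2 : ℝ)) ^ (2 : ℝ) = Z ^ (2 / r) * m := by
    intro Z m
    rw [ENNReal.mul_rpow_of_nonneg _ _ (by norm_num), ← ENNReal.rpow_mul, ← ENNReal.rpow_mul,
      show 1 / r * 2 = 2 / r by ring, show (1 / 2 : ℝ) * 2 = 1 by norm_num, ENNReal.rpow_one]
  have h36 : (36 : ℝ≥0∞) ^ (1 / 2 : ℝ) = 6 := by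
    rw [show (36 : ℝ≥0∞) = 6 ^ (2 : ℝ) by
      rw [show (2 : ℝ) = ((2 : ℕ) : ℝ) by norm_num, ENNReal.rpow_natCast]; norm_num, ← ENNReal.rpow_mul]
    norm_num
  calc _ ≤ ∑ i ∈ s, ENNReal.ofReal (8 * W / η) * ((X i ^ (1 / r) * νv (E i) ^ (1 / 2 : ℝ)) *
        (Y i ^ (1 / r) * νu (E i) ^ (1 / 2 : ℝ))) := Finset.sum_le_sum hterm
    _ = ENNReal.ofReal (8 * W / η) * ∑ i ∈ s, ((X i ^ (1 / r) * νv (E i) ^ (1 / 2 : ℝ)) *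
        (Y i ^ (1 / r) * νu (E i) ^ (1 / 2 : ℝ))) := by rw [Finset.mul_sum]
    _ ≤ ENNReal.ofReal (8 * W / η) * ((∑ i ∈ s, (X i ^ (1 / r) * νv (E i) ^ (1 / 2 : ℝ)) ^ (2 : ℝ)) ^ (1 / 2 : ℝ) *
        (∑ i ∈ s, (Y i ^ (1 / r) * νu (E i) ^ (1 / 2 : ℝ)) ^ (2 : ℝ)) ^ (1 / 2 : ℝ)) :=
        mul_le_mul_right (ENNReal.inner_le_Lp_mul_Lq s _ _ Real.HolderConjugate.two_two) _
    _ ≤ ENNReal.ofReal (8 * W / η) * ((36 * ∫⁻ x, ENNReal.ofReal (f x ^ 2 * w x)) ^ (1 / 2 : ℝ) *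
        (36 * ∫⁻ x, ENNReal.ofReal (g x ^ 2 * (w x)⁻¹)) ^ (1 / 2 : ℝ)) := by
        simp_rw [hsq]
        gcongr
    _ = _ := by
        rw [ENNReal.mul_rpow_of_nonneg _ _ (by norm_num), ENNReal.mul_rpow_of_nonneg _ _ (by norm_num), h36,
          show 288 * W / η = 8 * W / η * 36 by ring, ENNReal.ofReal_mul (by positivity),
          show ENNReal.ofReal 36 = 6 * 6 by rw [ENNReal.ofReal_ofNat]; norm_num]
        ring

lemma const_three (W d r γ : ℝ) (hγ : 0 < γ) (hW : 1 ≤ W) (hd : d = 1 / (32 * W))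
    (hr : r = 2 * (1 + d) / (2 + d)) : (r - 1) ^ (-γ) ≤ 96 ^ γ * W ^ γ := by
  have hd0 : 0 < d := by rw [hd]; positivity
  have hd1 : d ≤ 1 := by rw [hd, div_le_one (by positivity)]; linarith
  have hW0 : 0 < W := by linarith
  have e : r - 1 = d / (2 + d) := by rw [hr]; field_simp; ring
  have e2 : (r - 1)⁻¹ = (2 + d) * (32 * W) := by
    rw [e, inv_div]
    nth_rewrite 2 [hd]
    field_simp
  have e3 : 0 < r - 1 := by rw [e]; positivity
  rw [Real.rpow_neg e3.le, ← Real.inv_rpow e3.le, e2, ← Real.mul_rpow (by norm_num) hW0.le]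
  apply Real.rpow_le_rpow (by positivity) _ hγ.le
  nlinarith

/-- if `T` satisfies the sparse bound
`|⟨Tf,g⟩| ≤ C(r−1)^{−γ} Σ_{Q∈𝒮} ⟨f⟩_{r,Q}⟨g⟩_{r,Q}|Q|` for all `1 < r ≤ 2` (with an
`η`-sparse family `𝒮` depending on `f, g, r`), then for every `w ∈ A₂`,
`‖T‖_{L²(w)→L²(w)} ≤ C′[w]_{A₂}^{1+γ}`. -/
theorem sparse_bound_implies_A2_bound
    (γ C η : ℝ) (hγ : 0 < γ) (hC : 0 < C) (hη : 0 < η) (hη1 : η < 1)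
    (T : (ℝ → ℝ) → ℝ → ℝ)
    (hTmeas : ∀ f : ℝ → ℝ, Measurable (T f))
    (hT : ∀ f g : ℝ → ℝ, Measurable f → Measurable g →
      (∃ R : ℝ, ∀ x, R < |x| → f x = 0) → (∃ R : ℝ, ∀ x, R < |x| → g x = 0) →
      (∃ B : ℝ, ∀ x, |f x| ≤ B) → (∃ B : ℝ, ∀ x, |g x| ≤ B) →
      ∀ r : ℝ, 1 < r → r ≤ 2 →
        Integrable (fun x => T f x * g x) ∧
        ∃ (Q : ℕ → ℝ × ℝ) (E : ℕ → Set ℝ),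
          (∀ n, (Q n).1 ≤ (Q n).2) ∧
          (∀ n, MeasurableSet (E n) ∧ E n ⊆ Set.Ioc (Q n).1 (Q n).2 ∧
            η * ((Q n).2 - (Q n).1) ≤ (volume (E n)).toReal) ∧
          (Pairwise (Function.onFun Disjoint E)) ∧
          |∫ x : ℝ, T f x * g x| ≤
            C * (r - 1) ^ (-γ) *
              ∑' n : ℕ,
                lrAvg r f (Q n).1 (Q n).2 * lrAvg r g (Q n).1 (Q n).2 *
                  ((Q n).2 - (Q n).1)) :
    ∃ C' : ℝ, 0 < C' ∧
      ∀ w : ℝ → ℝ, Measurable w → (∀ x, 0 < w x) →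
        LocallyIntegrable w volume → LocallyIntegrable (fun x => (w x)⁻¹) volume →
        ∀ W : ℝ, 1 ≤ W →
        (∀ a b : ℝ, a < b →
          intervalAvg w a b * intervalAvg (fun x => (w x)⁻¹) a b ≤ W) →
        ∀ f : ℝ → ℝ, Measurable f →
          (∃ R : ℝ, ∀ x, R < |x| → f x = 0) → (∃ B : ℝ, ∀ x, |f x| ≤ B) →
          (∫⁻ x : ℝ, ENNReal.ofReal (T f x ^ 2 * w x)) ≤
            ENNReal.ofReal ((C' * W ^ (1 + γ)) ^ 2) *
              ∫⁻ x : ℝ, ENNReal.ofReal (f x ^ 2 * w x) := by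
  refine ⟨C * 96 ^ γ * (288 / η), by positivity, ?_⟩
  intro w hw hpos hwi hsi W hW hA f hf hfR hfB
  have hW0 : 0 < W := by linarith
  set K : ℝ := C * 96 ^ γ * (288 / η) * W ^ (1 + γ) with hK
  have hK0 : 0 < K := by positivity
  set Xf := ∫⁻ x : ℝ, ENNReal.ofReal (f x ^ 2 * w x) with hXf
  by_cases hXtop : Xf = ∞
  · rw [hXtop, ENNReal.mul_top (by
      rw [Ne, ENNReal.ofReal_eq_zero, not_le]; positivity)]
    exact le_top
  obtain ⟨d, hd⟩ : ∃ d : ℝ, d = 1 / (32 * W) := ⟨_, rfl⟩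
  obtain ⟨r, hr⟩ : ∃ r : ℝ, r = 2 * (1 + d) / (2 + d) := ⟨_, rfl⟩
  have hd0 : 0 < d := by rw [hd]; positivity
  have hr1 : 1 < r := by rw [hr, lt_div_iff₀ (by positivity)]; linarith
  have hr2 : r ≤ 2 := by rw [hr, div_le_iff₀ (by positivity)]; linarith
  have hTm := hTmeas f
  -- truncation sets
  set S : ℕ → Set ℝ := fun n => {x | |x| ≤ n ∧ |T f x| ≤ n ∧ w x ≤ n} with hS
  have hSm : ∀ n, MeasurableSet (S n) := by
    intro n
    refine (measurableSet_le (measurable_id.abs) measurable_const).inter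
      ((measurableSet_le hTm.abs measurable_const).inter
        (measurableSet_le hw measurable_const))
  have hmain : ∀ n : ℕ, ∫⁻ x, (S n).indicator (fun x => ENNReal.ofReal (T f x ^ 2 * w x)) x ≤
      ENNReal.ofReal (K ^ 2) * Xf := by
    intro n
    set g : ℝ → ℝ := (S n).indicator (fun x => T f x * w x) with hg
    set XN := ∫⁻ x, (S n).indicator (fun x => ENNReal.ofReal (T f x ^ 2 * w x)) x with hXN
    have hgm : Measurable g := Measurable.indicator (by fun_prop) (hSm n)
    have hgR : ∃ R : ℝ, ∀ x, R < |x| → g x = 0 := by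
      refine ⟨n, fun x hx => Set.indicator_of_notMem (fun h => ?_) _⟩
      exact absurd h.1 (not_le.2 hx)
    have hgB : ∃ B : ℝ, ∀ x, |g x| ≤ B := by
      refine ⟨n * n, fun x => ?_⟩
      by_cases hx : x ∈ S n
      · rw [hg, Set.indicator_of_mem hx, abs_mul, abs_of_pos (hpos x)]
        exact mul_le_mul hx.2.1 hx.2.2 (hpos x).le (by positivity)
      · rw [hg, Set.indicator_of_notMem hx, abs_zero]
        positivity
    obtain ⟨hintg, Q, E, hQ, hE, hdj, hbd⟩ := hT f g hf hgm hfR hgR hfB hgB r hr1 hr2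
    have hpt : ∀ x, ENNReal.ofReal (T f x * g x) =
        (S n).indicator (fun x => ENNReal.ofReal (T f x ^ 2 * w x)) x := by
      intro x
      by_cases hx : x ∈ S n
      · rw [hg, Set.indicator_of_mem hx, Set.indicator_of_mem hx]
        congr 1; ring
      · rw [hg, Set.indicator_of_notMem hx, Set.indicator_of_notMem hx]; simp
    have hnn : ∀ x, 0 ≤ T f x * g x := by
      intro x
      by_cases hx : x ∈ S n
      · rw [hg, Set.indicator_of_mem hx]
        have := (hpos x).le
        have h2 : T f x * (T f x * w x) = T f x ^ 2 * w x := by ring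
        rw [h2]; positivity
      · rw [hg, Set.indicator_of_notMem hx]; simp
    have hXNeq : ENNReal.ofReal (∫ x, T f x * g x) = XN := by
      rw [ofReal_integral_eq_lintegral_ofReal hintg (Filter.Eventually.of_forall hnn)]
      exact lintegral_congr hpt
    have hXNtop : XN ≠ ∞ := by rw [← hXNeq]; exact ENNReal.ofReal_ne_top
    have hgw : ∫⁻ x, ENNReal.ofReal (g x ^ 2 * (w x)⁻¹) = XN := by
      refine lintegral_congr fun x => ?_
      by_cases hx : x ∈ S n
      · rw [hg, Set.indicator_of_mem hx, Set.indicator_of_mem hx]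
        congr 1
        have := (hpos x).ne'
        field_simp
      · rw [hg, Set.indicator_of_notMem hx, Set.indicator_of_notMem hx]; simp
    set R := ENNReal.ofReal (288 * W / η) * (Xf ^ (1 / 2 : ℝ) * XN ^ (1 / 2 : ℝ)) with hR
    have hRtop : R ≠ ∞ := by
      refine ENNReal.mul_ne_top ENNReal.ofReal_ne_top (ENNReal.mul_ne_top ?_ ?_) <;>
      exact ENNReal.rpow_ne_top_of_nonneg (by norm_num) (by assumption)
    have hlr0 : ∀ (h : ℝ → ℝ) (k : ℕ), 0 ≤ lrAvg r h (Q k).1 (Q k).2 := by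
      intro h k
      have h1 : 0 ≤ (Q k).2 - (Q k).1 := by linarith [hQ k]
      have h2 : 0 ≤ ∫ x in Set.Ioc (Q k).1 (Q k).2, |h x| ^ r :=
        integral_nonneg fun x => by positivity
      rw [lrAvg]; positivity
    have hterm0 : ∀ k, 0 ≤ lrAvg r f (Q k).1 (Q k).2 * lrAvg r g (Q k).1 (Q k).2 *
        ((Q k).2 - (Q k).1) := by
      intro k
      have h1 : 0 ≤ (Q k).2 - (Q k).1 := by linarith [hQ k]
      exact mul_nonneg (mul_nonneg (hlr0 f k) (hlr0 g k)) h1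
    have hts : ∑' k : ℕ, lrAvg r f (Q k).1 (Q k).2 * lrAvg r g (Q k).1 (Q k).2 *
        ((Q k).2 - (Q k).1) ≤ R.toReal := by
      refine tsum_le_of_sum_le' ENNReal.toReal_nonneg fun s => ?_
      rw [← ENNReal.ofReal_le_iff_le_toReal hRtop,
        ENNReal.ofReal_sum_of_nonneg (fun k _ => hterm0 k)]
      have h1 := sparse_fin w hw hpos hwi hsi W hW hA d r η hη hd hr f g hf hfB hgm hgB
        (fun k => (Q k).1) (fun k => (Q k).2) E (s.filter fun k => (Q k).1 < (Q k).2)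
        (fun k hk => (Finset.mem_filter.1 hk).2) (fun k _ => (hE k).1) (fun k _ => (hE k).2.1)
        (fun k _ => (hE k).2.2) hdj
      rw [hgw] at h1
      refine le_trans (le_of_eq ?_) h1
      symm
      refine Finset.sum_filter_of_ne fun k _ hk => ?_
      by_contra hlt
      apply hk
      have : (Q k).1 = (Q k).2 := le_antisymm (hQ k) (not_lt.1 hlt)
      simp [this]
    have hX1 : XN ≤ (ENNReal.ofReal K * Xf ^ (1 / 2 : ℝ)) * XN ^ (1 / 2 : ℝ) := by
      have hr10 : 0 ≤ (r - 1) ^ (-γ) := Real.rpow_nonneg (by linarith) _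
      have h1 : ∫ x, T f x * g x ≤ C * (96 ^ γ * W ^ γ) * R.toReal := by
        refine (le_abs_self _).trans (hbd.trans ?_)
        have h3 := const_three W d r γ hγ hW hd hr
        refine mul_le_mul (by gcongr) hts (tsum_nonneg hterm0) (by positivity)
      have h2 := ENNReal.ofReal_le_ofReal h1
      rw [hXNeq, ENNReal.ofReal_mul (by positivity), ENNReal.ofReal_toReal hRtop, hR, ← mul_assoc,
        ← ENNReal.ofReal_mul (by positivity)] at h2
      have e : C * (96 ^ γ * W ^ γ) * (288 * W / η) = K := by
        rw [hK, Real.rpow_add hW0, Real.rpow_one]; ring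
      rw [e, ← mul_assoc] at h2
      exact h2
    by_cases hX0 : XN = 0
    · rw [hX0]; exact zero_le
    have h2 : XN = XN ^ (1 / 2 : ℝ) * XN ^ (1 / 2 : ℝ) := by
      rw [← ENNReal.rpow_add _ _ hX0 hXNtop]; norm_num
    have h0 : XN ^ (1 / 2 : ℝ) ≠ 0 := by
      simp [ENNReal.rpow_eq_zero_iff, hX0]
    have h00 : XN ^ (1 / 2 : ℝ) ≠ ∞ := ENNReal.rpow_ne_top_of_nonneg (by norm_num) hXNtop
    have h3 : XN ^ (1 / 2 : ℝ) ≤ ENNReal.ofReal K * Xf ^ (1 / 2 : ℝ) := by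
      rw [← ENNReal.mul_le_mul_iff_left h0 h00, ← h2]
      exact hX1
    have h4 := ENNReal.rpow_le_rpow h3 (by norm_num : (0 : ℝ) ≤ 2)
    rw [ENNReal.mul_rpow_of_nonneg _ _ (by norm_num), ← ENNReal.rpow_mul, ← ENNReal.rpow_mul,
      show (1 / 2 : ℝ) * 2 = 1 by norm_num, ENNReal.rpow_one, ENNReal.rpow_one,
      ENNReal.ofReal_rpow_of_nonneg hK0.le (by norm_num), Real.rpow_two] at h4
    exact h4
  have hlim : Filter.Tendsto (fun n : ℕ => ∫⁻ x, (S n).indicator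
      (fun x => ENNReal.ofReal (T f x ^ 2 * w x)) x) Filter.atTop
      (nhds (∫⁻ x, ENNReal.ofReal (T f x ^ 2 * w x))) := by
    refine lintegral_tendsto_of_tendsto_of_monotone
      (fun n => (Measurable.indicator (by fun_prop) (hSm n)).aemeasurable) ?_ ?_
    · refine Filter.Eventually.of_forall fun x n k hnk => ?_
      refine Set.indicator_le_indicator_of_subset ?_ (fun _ => zero_le) x
      have h2 : (n : ℝ) ≤ k := Nat.cast_le.2 hnk
      exact fun y hy => ⟨hy.1.trans h2, hy.2.1.trans h2, hy.2.2.trans h2⟩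
    · refine Filter.Eventually.of_forall fun x => ?_
      refine tendsto_const_nhds.congr' ?_
      obtain ⟨n0, hn0⟩ := exists_nat_ge (max |x| (max |T f x| (w x)))
      filter_upwards [Filter.eventually_ge_atTop n0] with n hn
      have h2 : (n0 : ℝ) ≤ n := Nat.cast_le.2 hn
      have h3 := hn0.trans h2
      rw [max_le_iff, max_le_iff] at h3
      rw [Set.indicator_of_mem (show x ∈ S n from h3)]
  exact le_of_tendsto' hlim hmain
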